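/- arXiv:1607.00367 — 3 statements merged into one kernel-verified Lean document; each statement's English description precedes it below -/
import Mathlib

section
/- Let (𝔤,⟨·,·⟩) be a metric Lie algebra with an abelian ideal 𝔲 of codimension 1 and b ∈ 𝔤 orthogonal to 𝔲 with [b,x] = x for all x ∈ 𝔲. Then the curvature tensor R̃ of the tangent algebra T𝔤 satisfies, for all x, y ∈ 𝔲: R̃(x^c,y^c)b^c = R̃(x^c,y^c)b^v = R̃(x^c,y^v)b^c = R̃(x^c,y^v)b^v = R̃(x^v,y^v)b^c = R̃(x^v,y^v)b^v = 0. -/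
/-- Bracket of the tangent Lie algebra `T𝔤 = 𝔤 × 𝔤`. -/
def tangentBracket {G : Type*} [LieRing G] (p q : G × G) : G × G :=
  (⁅p.1, q.1⁆, ⁅p.1, q.2⁆ + ⁅p.2, q.1⁆)

/-- The lifted inner product on `T𝔤 = 𝔤 × 𝔤`. -/
def tangentInner {G : Type*} [AddCommGroup G] [Module ℝ G]
    (inn : G →ₗ[ℝ] G →ₗ[ℝ] ℝ) (p q : G × G) : ℝ :=
  inn p.1 q.1 + inn p.2 q.2

/-- Curvature tensor `R(x,y)z = ∇ₓ∇_y z − ∇_y∇ₓ z − ∇_{[x,y]} z` of a product `∇`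
with respect to a bracket `br`. -/
def curvature {A : Type*} [AddCommGroup A] (br : A → A → A) (nab : A → A → A)
    (x y z : A) : A :=
  nab x (nab y z) - nab y (nab x z) - nab (br x y) z

theorem tangentInner_left_injective {G : Type*} [AddCommGroup G] [Module ℝ G]
    (inn : G →ₗ[ℝ] G →ₗ[ℝ] ℝ) (hpos : ∀ x : G, x ≠ 0 → 0 < inn x x) {p q : G × G}
    (h : ∀ r, tangentInner inn p r = tangentInner inn q r) : p = q := by
  have eq_of_inn {a c : G} (hac : ∀ z, inn a z = inn c z) : a = c := by
    by_contra hne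
    have := hpos (a - c) (sub_ne_zero.mpr hne)
    rw [map_sub inn, LinearMap.sub_apply, hac, sub_self] at this
    exact lt_irrefl _ this
  refine Prod.ext (eq_of_inn fun z => ?_) (eq_of_inn fun z => ?_)
  · simpa [tangentInner] using h (z, 0)
  · simpa [tangentInner] using h (0, z)

theorem Submodule.exists_eq_add_smul_of_finrank_eq {G : Type*} [AddCommGroup G] [Module ℝ G]
    [Module.Finite ℝ G] (u : Submodule ℝ G)
    (hcodim : Module.finrank ℝ G = Module.finrank ℝ u + 1) {b : G} (hb : b ∉ u) (z : G) :
    ∃ w ∈ u, ∃ t : ℝ, z = w + t • b := by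
  have hb0 : b ≠ 0 := fun h => hb (h ▸ u.zero_mem)
  have htop : u ⊔ Submodule.span ℝ {b} = ⊤ := by
    refine Submodule.eq_top_of_disjoint _ _ ?_ ?_
    · rw [finrank_span_singleton hb0, hcodim]
    · exact (Submodule.disjoint_span_singleton' hb0).mpr hb
  have hz : z ∈ u ⊔ Submodule.span ℝ {b} := htop ▸ Submodule.mem_top
  obtain ⟨w, hw, v, hv, rfl⟩ := Submodule.mem_sup.mp hz
  obtain ⟨t, rfl⟩ := Submodule.mem_span_singleton.mp hv
  exact ⟨w, hw, t, rfl⟩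

/-- Let `(𝔤,⟨·,·⟩)` be a metric Lie algebra with an abelian ideal `𝔲` of codimension `1`
and `b` orthogonal to `𝔲` with `[b,x] = x` for all `x ∈ 𝔲`.  Then the curvature tensor
`R̃` of the tangent algebra `T𝔤` kills the lifts of `b` in the directions of `𝔲`-lifts:
`R̃(x^c,y^c)b^c = R̃(x^c,y^c)b^v = R̃(x^c,y^v)b^c = R̃(x^c,y^v)b^v
  = R̃(x^v,y^v)b^c = R̃(x^v,y^v)b^v = 0`. -/
theorem special_tangent_curvature_b_vanishes
    {G : Type*} [LieRing G] [LieAlgebra ℝ G] [Module.Finite ℝ G]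
    (inn : G →ₗ[ℝ] G →ₗ[ℝ] ℝ)
    (hsymm : ∀ x y : G, inn x y = inn y x)
    (hpos : ∀ x : G, x ≠ 0 → 0 < inn x x)
    (u : LieIdeal ℝ G)
    (hab : ∀ x ∈ u, ∀ y ∈ u, ⁅x, y⁆ = (0 : G))
    (hcodim : Module.finrank ℝ G = Module.finrank ℝ u + 1)
    (b : G)
    (hborth : ∀ x ∈ u, inn b x = 0)
    (hbx : ∀ x ∈ u, ⁅b, x⁆ = x)
    (tnabla : G × G → G × G → G × G)
    (htkoszul : ∀ p q r : G × G,
      2 * tangentInner inn (tnabla p q) r =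
        tangentInner inn (tangentBracket p q) r
          - tangentInner inn (tangentBracket q r) p
          + tangentInner inn (tangentBracket r p) q) :
    ∀ x ∈ u, ∀ y ∈ u,
      curvature tangentBracket tnabla (x, 0) (y, 0) (b, 0) = 0 ∧
      curvature tangentBracket tnabla (x, 0) (y, 0) (0, b) = 0 ∧
      curvature tangentBracket tnabla (x, 0) (0, y) (b, 0) = 0 ∧
      curvature tangentBracket tnabla (x, 0) (0, y) (0, b) = 0 ∧
      curvature tangentBracket tnabla (0, x) (0, y) (b, 0) = 0 ∧
      curvature tangentBracket tnabla (0, x) (0, y) (0, b) = 0 := by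
  intro x hx y hy
  have hinj {p q : G × G} := tangentInner_left_injective inn hpos (p := p) (q := q)
  have hzero (q : G × G) : tnabla 0 q = 0 := by
    refine hinj fun r => ?_
    have := htkoszul 0 q r
    simp [tangentInner, tangentBracket] at this ⊢
    linarith
  have hsmul (c : ℝ) (p q : G × G) : tnabla p (c • q) = c • tnabla p q := by
    refine hinj fun r => ?_
    have h1 := htkoszul p (c • q) r
    have h2 := htkoszul p q r
    simp [tangentInner, tangentBracket] at h1 h2 ⊢
    linear_combination (1 / 2) * h1 - (c / 2) * h2
  by_cases hb : b ∈ u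
  · have hb0 : b = 0 := by
      by_contra hne
      exact (hpos b hne).ne' (hborth b hb)
    obtain rfl : x = 0 := by simpa [hb0] using (hbx x hx).symm
    obtain rfl : y = 0 := by simpa [hb0] using (hbx y hy).symm
    have h00 : ((0, 0) : G × G) = 0 := rfl
    have hbr : tangentBracket (0 : G × G) 0 = 0 := by simp [tangentBracket]
    simp [curvature, h00, hzero, hbr]
  have hdec := Submodule.exists_eq_add_smul_of_finrank_eq u.toSubmodule hcodim hb
  have hinj' {p q : G × G} (h : ∀ w₁ ∈ u, ∀ w₂ ∈ u, ∀ t₁ t₂ : ℝ,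
      tangentInner inn p (w₁ + t₁ • b, w₂ + t₂ • b) =
        tangentInner inn q (w₁ + t₁ • b, w₂ + t₂ • b)) : p = q := by
    refine hinj fun ⟨r₁, r₂⟩ => ?_
    obtain ⟨w₁, hw₁, t₁, rfl⟩ := hdec r₁
    obtain ⟨w₂, hw₂, t₂, rfl⟩ := hdec r₂
    exact h w₁ hw₁ w₂ hw₂ t₁ t₂
  have hborth' (z : G) (hz : z ∈ u) : inn z b = 0 := by rw [hsymm, hborth z hz]
  have hxb (z : G) (hz : z ∈ u) : ⁅z, b⁆ = -z := by rw [← lie_skew, hbx z hz]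
  have hb_cc (z : G) (hz : z ∈ u) : tnabla (z, 0) (b, 0) = (-1 : ℝ) • (z, 0) := by
    refine hinj' fun w₁ hw₁ w₂ hw₂ t₁ t₂ => ?_
    have h := htkoszul (z, 0) (b, 0) (w₁ + t₁ • b, w₂ + t₂ • b)
    simp [tangentInner, tangentBracket, hbx, hxb, hab, hborth', hz, hw₁, hw₂,
      hsymm w₁ z] at h ⊢
    linarith
  have hb_cv (z : G) (hz : z ∈ u) : tnabla (z, 0) (0, b) = (-1 / 2 : ℝ) • (0, z) := by
    refine hinj' fun w₁ hw₁ w₂ hw₂ t₁ t₂ => ?_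
    have h := htkoszul (z, 0) (0, b) (w₁ + t₁ • b, w₂ + t₂ • b)
    simp [tangentInner, tangentBracket, hbx, hxb, hab, hborth', hz, hw₁, hw₂] at h ⊢
    linarith
  have hb_vc (z : G) (hz : z ∈ u) : tnabla (0, z) (b, 0) = (-1 : ℝ) • (0, z) := by
    refine hinj' fun w₁ hw₁ w₂ hw₂ t₁ t₂ => ?_
    have h := htkoszul (0, z) (b, 0) (w₁ + t₁ • b, w₂ + t₂ • b)
    simp [tangentInner, tangentBracket, hbx, hxb, hab, hborth', hz, hw₁, hw₂,
      hsymm w₂ z] at h ⊢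
    linarith
  have hb_vv (z : G) (hz : z ∈ u) : tnabla (0, z) (0, b) = (-1 / 2 : ℝ) • (z, 0) := by
    refine hinj' fun w₁ hw₁ w₂ hw₂ t₁ t₂ => ?_
    have h := htkoszul (0, z) (0, b) (w₁ + t₁ • b, w₂ + t₂ • b)
    simp [tangentInner, tangentBracket, hbx, hxb, hab, hborth', hz, hw₁, hw₂,
      hsymm w₁ z] at h ⊢
    linarith
  have hu_cc (z : G) (hz : z ∈ u) (w : G) (hw : w ∈ u) :
      tnabla (z, 0) (w, 0) = tnabla (w, 0) (z, 0) := by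
    refine hinj' fun w₁ hw₁ w₂ hw₂ t₁ t₂ => ?_
    have h₁ := htkoszul (z, 0) (w, 0) (w₁ + t₁ • b, w₂ + t₂ • b)
    have h₂ := htkoszul (w, 0) (z, 0) (w₁ + t₁ • b, w₂ + t₂ • b)
    simp [tangentInner, tangentBracket, hbx, hxb, hab, hz, hw, hw₁, hw₂, hsymm w z]
      at h₁ h₂ ⊢
    linarith
  have hu_cv (z : G) (hz : z ∈ u) (w : G) (hw : w ∈ u) :
      tnabla (z, 0) (0, w) = tnabla (w, 0) (0, z) := by
    refine hinj' fun w₁ hw₁ w₂ hw₂ t₁ t₂ => ?_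
    have h₁ := htkoszul (z, 0) (0, w) (w₁ + t₁ • b, w₂ + t₂ • b)
    have h₂ := htkoszul (w, 0) (0, z) (w₁ + t₁ • b, w₂ + t₂ • b)
    simp [tangentInner, tangentBracket, hbx, hxb, hab, hz, hw, hw₁, hw₂, hsymm w z]
      at h₁ h₂ ⊢
    linarith
  have hu_cv_vc (z : G) (hz : z ∈ u) (w : G) (hw : w ∈ u) :
      tnabla (z, 0) (0, w) = tnabla (0, w) (z, 0) := by
    refine hinj' fun w₁ hw₁ w₂ hw₂ t₁ t₂ => ?_
    have h₁ := htkoszul (z, 0) (0, w) (w₁ + t₁ • b, w₂ + t₂ • b)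
    have h₂ := htkoszul (0, w) (z, 0) (w₁ + t₁ • b, w₂ + t₂ • b)
    simp [tangentInner, tangentBracket, hbx, hxb, hab, hz, hw, hw₁, hw₂]
      at h₁ h₂ ⊢
    linarith
  have hu_cc_vv (z : G) (hz : z ∈ u) (w : G) (hw : w ∈ u) :
      tnabla (z, 0) (w, 0) = tnabla (0, w) (0, z) := by
    refine hinj' fun w₁ hw₁ w₂ hw₂ t₁ t₂ => ?_
    have h₁ := htkoszul (z, 0) (w, 0) (w₁ + t₁ • b, w₂ + t₂ • b)
    have h₂ := htkoszul (0, w) (0, z) (w₁ + t₁ • b, w₂ + t₂ • b)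
    simp [tangentInner, tangentBracket, hbx, hxb, hab, hz, hw, hw₁, hw₂, hsymm w z]
      at h₁ h₂ ⊢
    linarith
  have hbr_cc : tangentBracket (x, 0) (y, 0) = 0 := by simp [tangentBracket, hab x hx y hy]
  have hbr_cv : tangentBracket (x, 0) (0, y) = 0 := by simp [tangentBracket, hab x hx y hy]
  have hbr_vv : tangentBracket (0, x) (0, y) = 0 := by simp [tangentBracket]
  simp only [curvature, hbr_cc, hbr_cv, hbr_vv, hzero, hb_cc x hx, hb_cc y hy, hb_cv x hx,
    hb_cv y hy, hb_vc x hx, hb_vc y hy, hb_vv x hx, hb_vv y hy, hsmul, sub_zero,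
    ← smul_sub, smul_eq_zero, sub_eq_zero]
  exact ⟨.inr (hu_cc x hx y hy), .inr (hu_cv x hx y hy), .inr (hu_cv_vc x hx y hy),
    .inr (hu_cc_vv x hx y hy), .inr ((hu_cc_vv y hy x hx).symm.trans ((hu_cc y hy x hx).trans
      (hu_cc_vv x hx y hy))), .inr ((hu_cv_vc y hy x hx).symm.trans (hu_cv y hy x hx |>.trans
      (hu_cv_vc x hx y hy)))⟩
end

section
/- Let (𝔤,⟨·,·⟩) be a metric Lie algebra with an abelian ideal 𝔲 of codimension 1 and b ∈ 𝔤 orthogonal to 𝔲 with [b,x] = x for all x ∈ 𝔲. Then the sectional curvature K̃ of the tangent algebra T𝔤 takes positive, negative, and zero values: there exist pairs of linearly independent vectors (w₁,w₂), (w₃,w₄), (w₅,w₆) in T𝔤 such that K̃(w₁,w₂) > 0, K̃(w₃,w₄) < 0, and K̃(w₅,w₆) = 0. -/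
/-- Sectional curvature `K(x,y) = ⟨R(x,y)y,x⟩ / (⟨x,x⟩⟨y,y⟩ − ⟨x,y⟩²)`. -/
noncomputable def sectional {A : Type*} (ip : A → A → ℝ) (R : A → A → A → A)
    (x y : A) : ℝ :=
  ip (R x y y) x / (ip x x * ip y y - ip x y ^ 2)

/-- A vector outside a subspace of codimension one spans a complement of that subspace. -/
lemma exists_smul_add_mem_of_codim_one {G : Type*} [AddCommGroup G] [Module ℝ G]
    [Module.Finite ℝ G] (u : Submodule ℝ G) {b : G} (hb : b ∉ u)
    (hcodim : Module.finrank ℝ G = Module.finrank ℝ u + 1) (r : G) :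
    ∃ t : ℝ, ∃ y ∈ u, r = t • b + y := by
  have hlt : u < u ⊔ Submodule.span ℝ {b} :=
    lt_of_le_of_ne le_sup_left fun h =>
      hb (h ▸ (le_sup_right : _ ≤ u ⊔ Submodule.span ℝ {b})
        (Submodule.mem_span_singleton_self b))
  have htop : u ⊔ Submodule.span ℝ {b} = ⊤ := by
    apply Submodule.eq_top_of_finrank_eq
    have h₁ := Submodule.finrank_lt_finrank_of_lt hlt
    have h₂ := Submodule.finrank_le (u ⊔ Submodule.span ℝ {b})
    omega
  have hr : r ∈ u ⊔ Submodule.span ℝ {b} := htop ▸ Submodule.mem_top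
  obtain ⟨y, hy, z, hz, rfl⟩ := Submodule.mem_sup.1 hr
  obtain ⟨t, rfl⟩ := Submodule.mem_span_singleton.1 hz
  exact ⟨t, y, hy, add_comm _ _⟩

/-- Vectors of `T𝔤` are determined by their inner products. -/
lemma eq_of_forall_tangentInner_eq {G : Type*} [AddCommGroup G] [Module ℝ G]
    (inn : G →ₗ[ℝ] G →ₗ[ℝ] ℝ) (hpos : ∀ x : G, x ≠ 0 → 0 < inn x x) {v w : G × G}
    (h : ∀ r, tangentInner inn v r = tangentInner inn w r) : v = w := by
  have key : ∀ x : G, inn x x = 0 → x = 0 := fun x hx => by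
    by_contra hne
    exact (hpos x hne).ne' hx
  refine Prod.ext (sub_eq_zero.1 (key _ ?_)) (sub_eq_zero.1 (key _ ?_))
  · simpa [tangentInner, sub_eq_zero] using h (v.1 - w.1, 0)
  · simpa [tangentInner, sub_eq_zero] using h (0, v.2 - w.2)

/-- Orthogonal nonzero vectors are linearly independent. -/
lemma linearIndependent_pair_of_tangentInner_eq_zero {G : Type*} [AddCommGroup G] [Module ℝ G]
    (inn : G →ₗ[ℝ] G →ₗ[ℝ] ℝ) {v w : G × G} (hv : 0 < tangentInner inn v v)
    (hw : 0 < tangentInner inn w w) (hvw : tangentInner inn v w = 0)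
    (hwv : tangentInner inn w v = 0) : LinearIndependent ℝ ![v, w] := by
  rw [LinearIndependent.pair_iff]
  intro s t h
  have h₁ : tangentInner inn (s • v + t • w) v = 0 := by simp [h, tangentInner]
  have h₂ : tangentInner inn (s • v + t • w) w = 0 := by simp [h, tangentInner]
  have e : ∀ r, tangentInner inn (s • v + t • w) r
      = s * tangentInner inn v r + t * tangentInner inn w r := fun r => by
    simp [tangentInner]
    ring
  rw [e] at h₁ h₂
  simp_all [hv.ne', hw.ne']

/-- Let `(𝔤,⟨·,·⟩)` be a metric Lie algebra with a nontrivial abelian ideal `𝔲` of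
codimension `1` (so `𝔤` is a non-abelian special Lie algebra in Milnor's sense) and `b`
orthogonal to `𝔲` with `[b,x] = x` for all `x ∈ 𝔲`.  Then the sectional curvature `K̃`
of the tangent algebra `T𝔤` takes positive, negative and zero values. -/
theorem special_tangent_sectional_signs
    {G : Type*} [LieRing G] [LieAlgebra ℝ G] [Module.Finite ℝ G]
    (inn : G →ₗ[ℝ] G →ₗ[ℝ] ℝ)
    (hsymm : ∀ x y : G, inn x y = inn y x)
    (hpos : ∀ x : G, x ≠ 0 → 0 < inn x x)
    (u : LieIdeal ℝ G)
    (hne : ∃ x ∈ u, x ≠ (0 : G))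
    (hab : ∀ x ∈ u, ∀ y ∈ u, ⁅x, y⁆ = (0 : G))
    (hcodim : Module.finrank ℝ G = Module.finrank ℝ u + 1)
    (b : G)
    (hborth : ∀ x ∈ u, inn b x = 0)
    (hbx : ∀ x ∈ u, ⁅b, x⁆ = x)
    (tnabla : G × G → G × G → G × G)
    (htkoszul : ∀ p q r : G × G,
      2 * tangentInner inn (tnabla p q) r =
        tangentInner inn (tangentBracket p q) r
          - tangentInner inn (tangentBracket q r) p
          + tangentInner inn (tangentBracket r p) q) :
    (∃ w₁ w₂ : G × G, LinearIndependent ℝ ![w₁, w₂] ∧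
      0 < sectional (tangentInner inn) (curvature tangentBracket tnabla) w₁ w₂) ∧
    (∃ w₃ w₄ : G × G, LinearIndependent ℝ ![w₃, w₄] ∧
      sectional (tangentInner inn) (curvature tangentBracket tnabla) w₃ w₄ < 0) ∧
    (∃ w₅ w₆ : G × G, LinearIndependent ℝ ![w₅, w₆] ∧
      sectional (tangentInner inn) (curvature tangentBracket tnabla) w₅ w₆ = 0) := by
  obtain ⟨x, hxu, hx0⟩ := hne
  have hx := hpos x hx0
  have hb0 : b ≠ 0 := fun h => hx0 (by simpa [h] using (hbx x hxu).symm)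
  have hb := hpos b hb0
  have hbu : b ∉ u := fun h => hb.ne' (hborth b h)
  have hdec := exists_smul_add_mem_of_codim_one u.toSubmodule hbu hcodim
  have hborth' : ∀ y ∈ u, inn y b = 0 := fun y hy => by rw [hsymm, hborth y hy]
  have hxb : ∀ y ∈ u, ⁅y, b⁆ = -y := fun y hy => by rw [← lie_skew, hbx y hy]
  have hnab : ∀ p q v : G × G,
      (∀ t s : ℝ, ∀ y ∈ u, ∀ z ∈ u, 2 * tangentInner inn v (t • b + y, s • b + z) =
        tangentInner inn (tangentBracket p q) (t • b + y, s • b + z)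
          - tangentInner inn (tangentBracket q (t • b + y, s • b + z)) p
          + tangentInner inn (tangentBracket (t • b + y, s • b + z) p) q) →
      tnabla p q = v := by
    intro p q v h
    refine eq_of_forall_tangentInner_eq inn hpos fun r => ?_
    obtain ⟨r₁, r₂⟩ := r
    obtain ⟨t, y, hy, rfl⟩ := hdec r₁
    obtain ⟨s, z, hz, rfl⟩ := hdec r₂
    linarith [h t s y hy z hz, htkoszul p q (t • b + y, s • b + z)]
  have hzero_left : ∀ q, tnabla 0 q = 0 := fun q => hnab _ _ _ <| by
    intros; simp [tangentInner, tangentBracket]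
  have hzero_right : ∀ p, tnabla p 0 = 0 := fun p => hnab _ _ _ <| by
    intros; simp [tangentInner, tangentBracket]
  have h_b₁_b₁ : ∀ c : ℝ, tnabla (b, 0) (c • b, 0) = 0 := fun c => hnab _ _ _ <| by
    intro t s y hy z hz
    simp [tangentInner, tangentBracket, hbx y hy, hxb y hy, hbx z hz, hxb z hz,
      hborth' y hy]
  have h_b₂_b₁ : ∀ c : ℝ, tnabla (0, b) (c • b, 0) = 0 := fun c => hnab _ _ _ <| by
    intro t s y hy z hz
    simp [tangentInner, tangentBracket, hbx y hy, hxb y hy, hbx z hz, hborth' z hz]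
  have h_b₁_b₂ : tnabla (b, 0) (0, b) = 0 := hnab _ _ _ <| by
    intro t s y hy z hz
    simp [tangentInner, tangentBracket, hbx y hy, hxb y hy, hxb z hz, hborth' z hz]
  have h_b₂_b₂ : tnabla (0, b) (0, b) = 0 := hnab _ _ _ <| by
    intro t s y hy z hz
    simp [tangentInner, tangentBracket, hbx y hy, hxb y hy, hborth' y hy]
  have h_b₁_x₁ : tnabla (b, 0) (x, 0) = 0 := hnab _ _ _ <| by
    intro t s y hy z hz
    simp [tangentInner, tangentBracket, hxb y hy, hxb z hz, hbx x hxu, hxb x hxu,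
      hborth' x hxu, hab x hxu y hy, hab x hxu z hz, hsymm y x]
  have h_x₁_x₁ : tnabla (x, 0) (x, 0) = ((inn x x / inn b b) • b, 0) := hnab _ _ _ <| by
    intro t s y hy z hz
    simp [tangentInner, tangentBracket, hxb x hxu, hbx x hxu, hborth y hy,
      hab x hxu y hy, hab y hy x hxu]
    field_simp
    ring
  have h_x₂_x₂ : tnabla (0, x) (0, x) = ((inn x x / inn b b) • b, 0) := hnab _ _ _ <| by
    intro t s y hy z hz
    simp [tangentInner, tangentBracket, hxb x hxu, hbx x hxu, hborth y hy,
      hab x hxu y hy, hab y hy x hxu]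
    field_simp
    ring
  have h_b₂_x₂ : tnabla (0, b) (0, x) = (-(1 / 2 : ℝ) • x, 0) := hnab _ _ _ <| by
    intro t s y hy z hz
    simp [tangentInner, tangentBracket, hxb x hxu, hxb y hy, hborth' x hxu,
      hab x hxu y hy, hsymm y x]
  have h_x₂_x₁ : tnabla (0, x) (-(1 / 2 : ℝ) • x, 0) =
      (0, -(inn x x / (4 * inn b b)) • b) := hnab _ _ _ <| by
    intro t s y hy z hz
    simp [tangentInner, tangentBracket, hxb x hxu, hbx x hxu, hborth z hz,
      hab x hxu y hy, hab x hxu z hz, hab y hy x hxu]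
    field_simp
    ring
  refine ⟨⟨(0, b), (0, x), ?_, ?_⟩, ⟨(b, 0), (x, 0), ?_, ?_⟩, ⟨(b, 0), (0, b), ?_, ?_⟩⟩
  · apply linearIndependent_pair_of_tangentInner_eq_zero inn <;>
      simp [tangentInner, hb, hx, hborth x hxu, hborth' x hxu]
  · have hbr : tangentBracket (0, b) (0, x) = 0 := by simp [tangentBracket]
    have hR : curvature tangentBracket tnabla (0, b) (0, x) (0, x) =
        (0, (inn x x / (4 * inn b b)) • b) := by
      rw [curvature, h_x₂_x₂, h_b₂_b₁, h_b₂_x₂, h_x₂_x₁, hbr, hzero_left]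
      simp
    rw [sectional, hR]
    simp only [tangentInner, map_zero, map_smul, LinearMap.smul_apply, smul_eq_mul,
      hborth x hxu, zero_add]
    norm_num
    positivity
  · apply linearIndependent_pair_of_tangentInner_eq_zero inn <;>
      simp [tangentInner, hb, hx, hborth x hxu, hborth' x hxu]
  · have hbr : tangentBracket (b, 0) (x, 0) = (x, 0) := by simp [tangentBracket, hbx x hxu]
    have hR : curvature tangentBracket tnabla (b, 0) (x, 0) (x, 0) =
        (-(inn x x / inn b b) • b, 0) := by
      rw [curvature, hbr, h_x₁_x₁, h_b₁_b₁, h_b₁_x₁, hzero_right]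
      simp
    rw [sectional, hR]
    simp only [tangentInner, map_zero, map_smul, LinearMap.smul_apply, smul_eq_mul,
      hborth x hxu, add_zero]
    apply div_neg_of_neg_of_pos
    · rw [neg_mul]
      exact neg_neg_of_pos (by positivity)
    · simp only [ne_eq, OfNat.ofNat_ne_zero, not_false_eq_true, zero_pow, sub_zero]
      positivity
  · apply linearIndependent_pair_of_tangentInner_eq_zero inn <;> simp [tangentInner, hb]
  · have hbr : tangentBracket (b, 0) (0, b) = 0 := by simp [tangentBracket]
    have hR : curvature tangentBracket tnabla (b, 0) (0, b) (0, b) = 0 := by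
      rw [curvature, h_b₂_b₂, h_b₁_b₂, hbr, hzero_left, hzero_right, hzero_right]
      simp
    simp [sectional, hR, tangentInner]
end

section
/- Let (𝔤,⟨·,·⟩) be a metric Lie algebra whose derived algebra is one-dimensional and spanned by a unit vector e, with Γ = e^⊥, a ∈ Γ satisfying [x,e] = ⟨a,x⟩e for all x ∈ Γ, and skew-adjoint f : Γ → Γ satisfying [x,y] = ⟨f(x),y⟩e for all x,y ∈ Γ. Then the sectional curvature K̃ of the tangent algebra T𝔤 takes both positive and negative values: there exist pairs of linearly independent vectors (w₁,w₂) and (w₃,w₄) in T𝔤 with K̃(w₁,w₂) > 0 and K̃(w₃,w₄) < 0; moreover, if dim 𝔤 ≥ 3, there also exists a pair of linearly independent vectors (w₅,w₆) in T𝔤 with K̃(w₅,w₆) = 0. -/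
theorem tangentBracket_skew {G : Type*} [LieRing G] (p q : G × G) : tangentBracket p q = -tangentBracket q p := by
  simp only [tangentBracket, Prod.neg_mk, neg_add, lie_skew, Prod.mk.injEq, true_and]
  rw [add_comm]

section TangentInner

variable {G : Type*} [AddCommGroup G] [Module ℝ G] (inn : G →ₗ[ℝ] G →ₗ[ℝ] ℝ)

theorem tangentInner_comm (hsymm : ∀ x y : G, inn x y = inn y x) (p q : G × G) :
    tangentInner inn p q = tangentInner inn q p := by
  simp only [tangentInner, hsymm p.1 q.1, hsymm p.2 q.2]

theorem tangentInner_sub_left (p q r : G × G) :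
    tangentInner inn (p - q) r = tangentInner inn p r - tangentInner inn q r := by
  simp [tangentInner]; ring

theorem tangentInner_add_left (p q r : G × G) :
    tangentInner inn (p + q) r = tangentInner inn p r + tangentInner inn q r := by
  simp [tangentInner]; ring

theorem tangentInner_smul_left (c : ℝ) (p r : G × G) :
    tangentInner inn (c • p) r = c * tangentInner inn p r := by
  simp [tangentInner]; ring

theorem tangentInner_self_pos (hpos : ∀ x : G, x ≠ 0 → 0 < inn x x) {p : G × G} (hp : p ≠ 0) :
    0 < tangentInner inn p p := by
  have hnonneg : ∀ x : G, 0 ≤ inn x x := fun x ↦ by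
    rcases eq_or_ne x 0 with rfl | hx
    · simp
    · exact (hpos x hx).le
  by_cases h₁ : p.1 = 0
  · have h₂ : p.2 ≠ 0 := fun h ↦ hp (Prod.ext h₁ h)
    exact add_pos_of_nonneg_of_pos (hnonneg _) (hpos _ h₂)
  · exact add_pos_of_pos_of_nonneg (hpos _ h₁) (hnonneg _)

theorem eq_of_tangentInner_eq (hpos : ∀ x : G, x ≠ 0 → 0 < inn x x) {p q : G × G}
    (h : ∀ r, tangentInner inn p r = tangentInner inn q r) : p = q := by
  by_contra hne
  have := tangentInner_self_pos inn hpos (sub_ne_zero.mpr hne)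
  rw [tangentInner_sub_left, h] at this
  simp at this

theorem linearIndependent_pair_of_tangentInner_eq_zero_s17
    (hsymm : ∀ x y : G, inn x y = inn y x) (hpos : ∀ x : G, x ≠ 0 → 0 < inn x x)
    {u v : G × G} (hu : u ≠ 0) (hv : v ≠ 0) (huv : tangentInner inn u v = 0) :
    LinearIndependent ℝ ![u, v] := by
  have hvu : tangentInner inn v u = 0 := by rw [tangentInner_comm inn hsymm, huv]
  refine LinearIndependent.pair_iff.mpr fun s t h ↦ ?_
  have key : ∀ r, s * tangentInner inn u r + t * tangentInner inn v r = 0 := fun r ↦ by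
    rw [← tangentInner_smul_left, ← tangentInner_smul_left, ← tangentInner_add_left, h]
    simp [tangentInner]
  have h₁ := key u
  have h₂ := key v
  rw [hvu, mul_zero, add_zero] at h₁
  rw [huv, mul_zero, zero_add] at h₂
  exact ⟨(mul_eq_zero.mp h₁).resolve_right (tangentInner_self_pos inn hpos hu).ne',
    (mul_eq_zero.mp h₂).resolve_right (tangentInner_self_pos inn hpos hv).ne'⟩

end TangentInner

section TangentCurvature

variable {G : Type*} [LieRing G] [LieAlgebra ℝ G] (inn : G →ₗ[ℝ] G →ₗ[ℝ] ℝ)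

/-- The Koszul formula characterising the Levi-Civita product of the tangent algebra. -/
def IsTangentLeviCivita (tnabla : G × G → G × G → G × G) : Prop :=
  ∀ p q r : G × G,
    2 * tangentInner inn (tnabla p q) r =
      tangentInner inn (tangentBracket p q) r
        - tangentInner inn (tangentBracket q r) p
        + tangentInner inn (tangentBracket r p) q

variable {inn} {tnabla : G × G → G × G → G × G}

theorem IsTangentLeviCivita.skew (h : IsTangentLeviCivita inn tnabla)
    (p q r : G × G) :
    tangentInner inn (tnabla p q) r = -tangentInner inn (tnabla p r) q := by
  have hneg : ∀ p q : G × G, tangentInner inn (-p) q = -tangentInner inn p q := fun p q ↦ by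
    simp [tangentInner]; ring
  have h₁ := h p q r
  have h₂ := h p r q
  rw [tangentBracket_skew r q, tangentBracket_skew q p, tangentBracket_skew p r,
    hneg, hneg, hneg] at h₂
  linarith

theorem IsTangentLeviCivita.curvature_eq (h : IsTangentLeviCivita inn tnabla)
    (hsymm : ∀ x y : G, inn x y = inn y x) (u v : G × G) :
    tangentInner inn (curvature tangentBracket tnabla u v v) u =
      tangentInner inn (tnabla u v) (tnabla v u)
        - tangentInner inn (tnabla u u) (tnabla v v)
        - tangentInner inn (tnabla (tangentBracket u v) v) u := by
  rw [curvature, tangentInner_sub_left, tangentInner_sub_left, h.skew u, h.skew v,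
    tangentInner_comm inn hsymm (tnabla v u)]
  ring

end TangentCurvature

section OneDimDerived

variable {G : Type*} [LieRing G] [LieAlgebra ℝ G] {inn : G →ₗ[ℝ] G →ₗ[ℝ] ℝ} {e a : G}
  {f : G →ₗ[ℝ] G}

theorem lie_unit_eq (hunit : inn e e = 1) (hsymm : ∀ x y : G, inn x y = inn y x)
    (haG : inn e a = 0) (haxe : ∀ x : G, inn e x = 0 → ⁅x, e⁆ = inn a x • e) (r : G) :
    ⁅r, e⁆ = inn a r • e := by
  have h := haxe (r - inn e r • e) (by simp [hunit])
  simpa [hsymm a e, haG] using h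

theorem lie_orthogonal_eq (hunit : inn e e = 1) (hsymm : ∀ x y : G, inn x y = inn y x)
    (haxe : ∀ x : G, inn e x = 0 → ⁅x, e⁆ = inn a x • e)
    (hfG : ∀ x : G, inn e x = 0 → inn e (f x) = 0)
    (hskew : ∀ x y : G, inn e x = 0 → inn e y = 0 → inn (f x) y = -inn x (f y))
    (hfbr : ∀ x y : G, inn e x = 0 → inn e y = 0 → ⁅x, y⁆ = inn (f x) y • e)
    {y : G} (hy : inn e y = 0) (r : G) :
    ⁅r, y⁆ = -inn r (inn a y • e + f y) • e := by
  have hr : inn e (r - inn e r • e) = 0 := by simp [hunit]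
  have h := hfbr (r - inn e r • e) y hr hy
  rw [hskew _ _ hr hy, sub_lie, smul_lie, ← lie_skew e y, haxe y hy, sub_eq_iff_eq_add] at h
  rw [h]
  simp only [map_sub, map_add, map_smul, LinearMap.sub_apply, LinearMap.smul_apply, smul_eq_mul,
    hfG y hy, hsymm r e]
  module

variable {tnabla : G × G → G × G → G × G}

theorem IsTangentLeviCivita.curvature_snd_snd (h : IsTangentLeviCivita inn tnabla)
    (hsymm : ∀ x y : G, inn x y = inn y x) (hpos : ∀ x : G, x ≠ 0 → 0 < inn x x)
    (hunit : inn e e = 1) {y m : G} (hy : inn e y = 0)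
    (he : ∀ r, ⁅r, e⁆ = inn a r • e) (hm : ∀ r, ⁅r, y⁆ = -inn r m • e) :
    tangentInner inn (curvature tangentBracket tnabla (0, e) (0, y) (0, y)) (0, e) =
      inn m m / 4 := by
  have he' : ∀ r, ⁅e, r⁆ = -(inn a r • e) := fun r ↦ by rw [← lie_skew, he]
  have hm' : ∀ r, ⁅y, r⁆ = inn r m • e := fun r ↦ by rw [← lie_skew, hm]; module
  have h₁ : tnabla (0, e) (0, y) = (-(1 / 2 : ℝ) • m, 0) :=
    eq_of_tangentInner_eq inn hpos fun r ↦ by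
      have := h (0, e) (0, y) r
      simp [tangentInner, tangentBracket, he, hm, he', hm', hunit, hy] at this ⊢
      linarith [hsymm m r.1]
  have h₂ : tnabla (0, y) (0, e) = (-(1 / 2 : ℝ) • m, 0) :=
    eq_of_tangentInner_eq inn hpos fun r ↦ by
      have := h (0, y) (0, e) r
      simp [tangentInner, tangentBracket, he, hm, he', hm', hunit, hy] at this ⊢
      linarith [hsymm m r.1]
  have h₃ : tnabla (0, y) (0, y) = 0 :=
    eq_of_tangentInner_eq inn hpos fun r ↦ by
      have := h (0, y) (0, y) r
      simp [tangentInner, tangentBracket, hm, hm', hy] at this ⊢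
      linarith
  have h₄ := h (tangentBracket (0, e) (0, y)) (0, y) (0, e)
  rw [h.curvature_eq hsymm, h₁, h₂, h₃]
  simp [tangentInner, tangentBracket] at h₄ ⊢
  linarith

theorem IsTangentLeviCivita.curvature_unit_snd (h : IsTangentLeviCivita inn tnabla)
    (hsymm : ∀ x y : G, inn x y = inn y x) (hpos : ∀ x : G, x ≠ 0 → 0 < inn x x)
    (hunit : inn e e = 1) {y m : G} (hy : inn e y = 0)
    (he : ∀ r, ⁅r, e⁆ = inn a r • e) (hm : ∀ r, ⁅r, y⁆ = -inn r m • e) :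
    tangentInner inn (curvature tangentBracket tnabla (e, 0) (0, y) (0, y)) (e, 0) =
      -(3 / 4) * inn a y ^ 2 := by
  have he' : ∀ r, ⁅e, r⁆ = -(inn a r • e) := fun r ↦ by rw [← lie_skew, he]
  have hm' : ∀ r, ⁅y, r⁆ = -(-inn r m • e) := fun r ↦ by rw [← lie_skew, hm]
  have hem : inn e m = inn a y := by
    have := congrArg (inn e) (he y)
    rw [hm'] at this
    simpa [hunit] using this
  have h₁ : tnabla (e, 0) (0, y) = (0, (-(1 / 2) * inn a y) • e) :=
    eq_of_tangentInner_eq inn hpos fun r ↦ by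
      have := h (e, 0) (0, y) r
      simp [tangentInner, tangentBracket, he, hm, he', hm', hy, hem] at this ⊢
      linarith
  have h₂ : tnabla (0, y) (e, 0) = (0, ((1 / 2) * inn a y) • e) :=
    eq_of_tangentInner_eq inn hpos fun r ↦ by
      have := h (0, y) (e, 0) r
      simp [tangentInner, tangentBracket, he, hm, he', hy] at this ⊢
      linarith
  have h₃ : tnabla (0, y) (0, y) = 0 :=
    eq_of_tangentInner_eq inn hpos fun r ↦ by
      have := h (0, y) (0, y) r
      simp [tangentInner, tangentBracket, hm, hm', hy] at this ⊢
      linarith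
  have h₄ := h (tangentBracket (e, 0) (0, y)) (0, y) (e, 0)
  rw [h.curvature_eq hsymm, h₁, h₂, h₃]
  simp [tangentInner, tangentBracket, he, hm, he', hunit, hy, hem] at h₄ ⊢
  linarith

theorem IsTangentLeviCivita.curvature_fst_snd (h : IsTangentLeviCivita inn tnabla)
    (hsymm : ∀ x y : G, inn x y = inn y x) (hpos : ∀ x : G, x ≠ 0 → 0 < inn x x)
    (hunit : inn e e = 1) {x y m n : G} (hy : inn e y = 0)
    (hn : ∀ r, ⁅r, x⁆ = -inn r n • e) (hm : ∀ r, ⁅r, y⁆ = -inn r m • e) :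
    tangentInner inn (curvature tangentBracket tnabla (x, 0) (0, y) (0, y)) (x, 0) =
      -(3 / 4) * inn x m ^ 2 := by
  have hn' : ∀ r, ⁅x, r⁆ = -(-inn r n • e) := fun r ↦ by rw [← lie_skew, hn]
  have hm' : ∀ r, ⁅y, r⁆ = -(-inn r m • e) := fun r ↦ by rw [← lie_skew, hm]
  have hnm : inn y n = -inn x m := by
    have := congrArg (inn e) ((hn' y).symm.trans (hm x))
    simpa [hunit] using this
  have h₁ : tnabla (x, 0) (0, y) = (0, (-(1 / 2) * inn x m) • e) :=
    eq_of_tangentInner_eq inn hpos fun r ↦ by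
      have := h (x, 0) (0, y) r
      simp [tangentInner, tangentBracket, hn, hm, hn', hm', hy] at this ⊢
      linarith
  have h₂ : tnabla (0, y) (x, 0) = (0, ((1 / 2) * inn x m) • e) :=
    eq_of_tangentInner_eq inn hpos fun r ↦ by
      have := h (0, y) (x, 0) r
      simp [tangentInner, tangentBracket, hn, hm, hn', hy, hnm] at this ⊢
      linarith
  have h₃ : tnabla (0, y) (0, y) = 0 :=
    eq_of_tangentInner_eq inn hpos fun r ↦ by
      have := h (0, y) (0, y) r
      simp [tangentInner, tangentBracket, hm, hm', hy] at this ⊢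
      linarith
  have h₄ := h (tangentBracket (x, 0) (0, y)) (0, y) (x, 0)
  rw [h.curvature_eq hsymm, h₁, h₂, h₃]
  simp [tangentInner, tangentBracket, hn, hm, hn', hunit, hy, hnm] at h₄ ⊢
  linarith

/-- A one-dimensional derived algebra forces some `y ⟂ e` not to be central. -/
theorem exists_orthogonal_noncentral (hunit : inn e e = 1)
    (hder : Submodule.span ℝ {z : G | ∃ x y : G, ⁅x, y⁆ = z} = Submodule.span ℝ ({e} : Set G))
    (hpos : ∀ x : G, x ≠ 0 → 0 < inn x x) (haG : inn e a = 0)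
    (he : ∀ r, ⁅r, e⁆ = inn a r • e) (hfG : ∀ x : G, inn e x = 0 → inn e (f x) = 0)
    (hm : ∀ y, inn e y = 0 → ∀ r, ⁅r, y⁆ = -inn r (inn a y • e + f y) • e) :
    ∃ y, inn e y = 0 ∧ inn a y • e + f y ≠ 0 := by
  by_contra! hc
  have ha : a = 0 := by
    by_contra hne
    have := congrArg (inn e) (hc a haG)
    simp [hunit, hfG a haG] at this
    exact (hpos a hne).ne' this
  have hlie : ∀ r s : G, ⁅r, s⁆ = 0 := fun r s ↦ by
    have h₀ : inn e (s - inn e s • e) = 0 := by simp [hunit]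
    have h₁ := hm _ h₀ r
    rw [hc _ h₀, lie_sub, lie_smul, he, ha] at h₁
    simpa using h₁
  have hmem : e ∈ Submodule.span ℝ {z : G | ∃ x y : G, ⁅x, y⁆ = z} :=
    hder ▸ Submodule.mem_span_singleton_self e
  have hbot : Submodule.span ℝ {z : G | ∃ x y : G, ⁅x, y⁆ = z} = ⊥ := by
    rw [Submodule.span_eq_bot]
    rintro z ⟨r, s, rfl⟩
    exact hlie r s
  rw [hbot, Submodule.mem_bot] at hmem
  simp [hmem] at hunit

end OneDimDerived

/-- Let `(𝔤,⟨·,·⟩)` be a metric Lie algebra whose derived algebra is one-dimensional and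
spanned by a unit vector `e`, with `Γ = e^⊥`, `a ∈ Γ` satisfying `[x,e] = ⟨a,x⟩e` for all
`x ∈ Γ`, and skew-adjoint `f : Γ → Γ` satisfying `[x,y] = ⟨f(x),y⟩e` for all `x,y ∈ Γ`.
Then the sectional curvature `K̃` of the tangent algebra `T𝔤` takes both positive and
negative values; moreover if `dim 𝔤 ≥ 3` it also takes the value zero. -/
theorem oneDimCommutator_tangent_sectional_signs
    {G : Type*} [LieRing G] [LieAlgebra ℝ G] [Module.Finite ℝ G]
    (inn : G →ₗ[ℝ] G →ₗ[ℝ] ℝ)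
    (hsymm : ∀ x y : G, inn x y = inn y x)
    (hpos : ∀ x : G, x ≠ 0 → 0 < inn x x)
    (e : G) (hunit : inn e e = 1)
    (hder : Submodule.span ℝ {z : G | ∃ x y : G, ⁅x, y⁆ = z} =
      Submodule.span ℝ ({e} : Set G))
    (a : G) (haG : inn e a = 0)
    (haxe : ∀ x : G, inn e x = 0 → ⁅x, e⁆ = inn a x • e)
    (f : G →ₗ[ℝ] G)
    (hfG : ∀ x : G, inn e x = 0 → inn e (f x) = 0)
    (hskew : ∀ x y : G, inn e x = 0 → inn e y = 0 → inn (f x) y = -inn x (f y))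
    (hfbr : ∀ x y : G, inn e x = 0 → inn e y = 0 → ⁅x, y⁆ = inn (f x) y • e)
    (tnabla : G × G → G × G → G × G)
    (htkoszul : ∀ p q r : G × G,
      2 * tangentInner inn (tnabla p q) r =
        tangentInner inn (tangentBracket p q) r
          - tangentInner inn (tangentBracket q r) p
          + tangentInner inn (tangentBracket r p) q) :
    (∃ w₁ w₂ : G × G, LinearIndependent ℝ ![w₁, w₂] ∧
      0 < sectional (tangentInner inn) (curvature tangentBracket tnabla) w₁ w₂) ∧
    (∃ w₃ w₄ : G × G, LinearIndependent ℝ ![w₃, w₄] ∧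
      sectional (tangentInner inn) (curvature tangentBracket tnabla) w₃ w₄ < 0) ∧
    (3 ≤ Module.finrank ℝ G →
      ∃ w₅ w₆ : G × G, LinearIndependent ℝ ![w₅, w₆] ∧
        sectional (tangentInner inn) (curvature tangentBracket tnabla) w₅ w₆ = 0) := by
  have hLC : IsTangentLeviCivita inn tnabla := htkoszul
  have he := lie_unit_eq hunit hsymm haG haxe
  have hm : ∀ y, inn e y = 0 → ∀ r, ⁅r, y⁆ = -inn r (inn a y • e + f y) • e :=
    fun y hy ↦ lie_orthogonal_eq hunit hsymm haxe hfG hskew hfbr hy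
  have he₀ : e ≠ 0 := by
    rintro rfl
    simp at hunit
  have hden : ∀ {u v : G × G}, u ≠ 0 → v ≠ 0 → tangentInner inn u v = 0 →
      0 < tangentInner inn u u * tangentInner inn v v - tangentInner inn u v ^ 2 := by
    intro u v hu hv huv
    rw [huv]
    simpa using mul_pos (tangentInner_self_pos inn hpos hu) (tangentInner_self_pos inn hpos hv)
  obtain ⟨y, hy, hne⟩ := exists_orthogonal_noncentral hunit hder hpos haG he hfG hm
  have hy₀ : y ≠ 0 := by
    rintro rfl
    simp at hne
  have hfst : ∀ {x : G}, x ≠ 0 → ((x, 0) : G × G) ≠ 0 := fun hx h ↦ hx (congrArg Prod.fst h)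
  have hsnd : ∀ {x : G}, x ≠ 0 → ((0, x) : G × G) ≠ 0 := fun hx h ↦ hx (congrArg Prod.snd h)
  have horth : ∀ x z : G, tangentInner inn (x, 0) (0, z) = 0 := fun x z ↦ by simp [tangentInner]
  refine ⟨⟨(0, e), (0, y), ?_, ?_⟩, ?_, fun _ ↦ ⟨(y, 0), (0, y), ?_, ?_⟩⟩
  · exact linearIndependent_pair_of_tangentInner_eq_zero_s17 inn hsymm hpos (hsnd he₀) (hsnd hy₀)
      (by simp [tangentInner, hy])
  · rw [sectional, hLC.curvature_snd_snd hsymm hpos hunit hy he (hm y hy)]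
    exact div_pos (by linarith [hpos _ hne])
      (hden (hsnd he₀) (hsnd hy₀) (by simp [tangentInner, hy]))
  · by_cases hfy : f y = 0
    · have hay : inn a y ≠ 0 := fun h ↦ hne (by simp [h, hfy])
      refine ⟨(e, 0), (0, y), linearIndependent_pair_of_tangentInner_eq_zero_s17 inn hsymm hpos
        (hfst he₀) (hsnd hy₀) (horth _ _), ?_⟩
      rw [sectional, hLC.curvature_unit_snd hsymm hpos hunit hy he (hm y hy)]
      exact div_neg_of_neg_of_pos (by linarith [sq_pos_of_ne_zero hay])
        (hden (hfst he₀) (hsnd hy₀) (horth _ _))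
    · refine ⟨(f y, 0), (0, y), linearIndependent_pair_of_tangentInner_eq_zero_s17 inn hsymm hpos
        (hfst hfy) (hsnd hy₀) (horth _ _), ?_⟩
      rw [sectional, hLC.curvature_fst_snd hsymm hpos hunit hy (hm _ (hfG y hy))
        (hm y hy)]
      have hval : inn (f y) (inn a y • e + f y) = inn (f y) (f y) := by
        simp [hsymm (f y) e, hfG y hy]
      rw [hval]
      exact div_neg_of_neg_of_pos (by linarith [pow_pos (hpos _ hfy) 2])
        (hden (hfst hfy) (hsnd hy₀) (horth _ _))
  · exact linearIndependent_pair_of_tangentInner_eq_zero_s17 inn hsymm hpos (hfst hy₀) (hsnd hy₀)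
      (horth _ _)
  · have hyy : inn y (inn a y • e + f y) = 0 := by
      have h₁ := hskew y y hy hy
      rw [hsymm (f y) y] at h₁
      simp only [map_add, map_smul, hsymm y e, hy, smul_zero, zero_add]
      linarith
    rw [sectional, hLC.curvature_fst_snd hsymm hpos hunit hy (hm y hy) (hm y hy), hyy]
    simp
end
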